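/- arXiv:1309.5048 — 6 statements merged into one kernel-verified Lean document; each statement's English description precedes it below -/
import Mathlib

section
/- Spectral equivalence of the Schur complement and the pressure mass matrix from inf-sup stability and boundedness: let Q be a real symmetric positive definite n_p×n_p matrix and β₀, C_b > 0. Assume (boundedness) ⟨B u, p⟩ ≤ C_b ⟨A u, u⟩^{1/2} ⟨Q p, p⟩^{1/2} for all u ∈ ℝ^{n_u} and p ∈ ℝ^{n_p}, and (inf-sup stability) for every p ∈ ℝ^{n_p} with Bᵀ p ≠ 0 there exists u ∈ ℝ^{n_u}, u ≠ 0, with ⟨B u, p⟩ ≥ β₀ ⟨A u, u⟩^{1/2} ⟨Q p, p⟩^{1/2}. Then for every p ∈ ℝ^{n_p} with Bᵀ p ≠ 0, β₀² ≤ ⟨S p, p⟩ / ⟨Q p, p⟩ ≤ C_b². -/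
open Matrix

namespace Matrix

variable {n : Type*} [Fintype n] {M : Matrix n n ℝ}

theorem PosDef.mulVec_dotProduct_pos (hM : M.PosDef) {x : n → ℝ} (hx : x ≠ 0) :
    0 < M *ᵥ x ⬝ᵥ x := by
  simpa [dotProduct_comm] using hM.dotProduct_mulVec_pos hx

theorem PosSemidef.mulVec_dotProduct_nonneg (hM : M.PosSemidef) (x : n → ℝ) :
    0 ≤ M *ᵥ x ⬝ᵥ x := by
  simpa [dotProduct_comm] using hM.dotProduct_mulVec_nonneg x

/-- The Cauchy–Schwarz inequality for the form of a positive semidefinite real matrix. -/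
theorem PosSemidef.sq_mulVec_dotProduct_le (hM : M.PosSemidef) (x y : n → ℝ) :
    (M *ᵥ x ⬝ᵥ y) ^ 2 ≤ (M *ᵥ x ⬝ᵥ x) * (M *ᵥ y ⬝ᵥ y) := by
  have hsymm : M *ᵥ y ⬝ᵥ x = M *ᵥ x ⬝ᵥ y := by
    have hT : Mᵀ = M := by simpa using hM.isHermitian.eq
    rw [dotProduct_comm, dotProduct_mulVec, ← mulVec_transpose, hT]
  have h := discrim_le_zero (a := M *ᵥ y ⬝ᵥ y) (b := 2 * (M *ᵥ x ⬝ᵥ y)) (c := M *ᵥ x ⬝ᵥ x)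
    fun t => by
      have := hM.mulVec_dotProduct_nonneg (x + t • y)
      simp only [mulVec_add, mulVec_smul, add_dotProduct, dotProduct_add, smul_dotProduct,
        dotProduct_smul, smul_eq_mul, hsymm] at this
      linarith
  rw [discrim] at h
  linarith

end Matrix

/-- Spectral equivalence of the Schur complement S = B A⁻¹ Bᵀ and the pressure
mass matrix Q from boundedness and inf-sup stability: for every p with
Bᵀ p ≠ 0, β₀² ≤ ⟨S p, p⟩ / ⟨Q p, p⟩ ≤ C_b². -/
theorem stmt_5 {nu np : ℕ} (hnu : 0 < nu) (hnp : 0 < np)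
    (A : Matrix (Fin nu) (Fin nu) ℝ) (hA : A.PosDef)
    (B : Matrix (Fin np) (Fin nu) ℝ)
    (Q : Matrix (Fin np) (Fin np) ℝ) (hQ : Q.PosDef)
    (β₀ Cb : ℝ) (hβ₀ : 0 < β₀) (hCb : 0 < Cb)
    (hbound : ∀ (u : Fin nu → ℝ) (p : Fin np → ℝ),
      B *ᵥ u ⬝ᵥ p ≤ Cb * Real.sqrt (A *ᵥ u ⬝ᵥ u) * Real.sqrt (Q *ᵥ p ⬝ᵥ p))
    (hinfsup : ∀ p : Fin np → ℝ, Bᵀ *ᵥ p ≠ 0 → ∃ u : Fin nu → ℝ, u ≠ 0 ∧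
      β₀ * Real.sqrt (A *ᵥ u ⬝ᵥ u) * Real.sqrt (Q *ᵥ p ⬝ᵥ p) ≤ B *ᵥ u ⬝ᵥ p) :
    ∀ p : Fin np → ℝ, Bᵀ *ᵥ p ≠ 0 →
      β₀ ^ 2 ≤ ((B * A⁻¹ * Bᵀ) *ᵥ p ⬝ᵥ p) / (Q *ᵥ p ⬝ᵥ p) ∧
      ((B * A⁻¹ * Bᵀ) *ᵥ p ⬝ᵥ p) / (Q *ᵥ p ⬝ᵥ p) ≤ Cb ^ 2 := by
  intro p hp
  set w := A⁻¹ *ᵥ (Bᵀ *ᵥ p) with hw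
  have hAw : A *ᵥ w = Bᵀ *ᵥ p := by
    rw [hw, mulVec_mulVec, mul_nonsing_inv _ hA.det_pos.ne'.isUnit, one_mulVec]
  have hB : ∀ u, B *ᵥ u ⬝ᵥ p = A *ᵥ w ⬝ᵥ u := fun u => by
    rw [hAw, mulVec_transpose, ← dotProduct_mulVec, dotProduct_comm]
  have hS : (B * A⁻¹ * Bᵀ) *ᵥ p ⬝ᵥ p = A *ᵥ w ⬝ᵥ w := by
    rw [← hB, hw, mulVec_mulVec, mulVec_mulVec, Matrix.mul_assoc]
  have hp0 : p ≠ 0 := by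
    rintro rfl
    simp at hp
  have hq : 0 < Q *ᵥ p ⬝ᵥ p := hQ.mulVec_dotProduct_pos hp0
  have hs : 0 ≤ A *ᵥ w ⬝ᵥ w := hA.posSemidef.mulVec_dotProduct_nonneg w
  rw [hS, le_div_iff₀ hq, div_le_iff₀ hq]
  constructor
  · obtain ⟨u, hu, h⟩ := hinfsup p hp
    rw [hB] at h
    have ha : 0 < A *ᵥ u ⬝ᵥ u := hA.mulVec_dotProduct_pos hu
    have hsq := pow_le_pow_left₀ (by positivity) h 2
    rw [mul_pow, mul_pow, Real.sq_sqrt ha.le, Real.sq_sqrt hq.le] at hsq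
    have hcs := hA.posSemidef.sq_mulVec_dotProduct_le w u
    exact le_of_mul_le_mul_right (by linarith) ha
  · have h := hbound w p
    rw [hB] at h
    have hsq := pow_le_pow_left₀ hs h 2
    rw [mul_pow, mul_pow, Real.sq_sqrt hs, Real.sq_sqrt hq.le] at hsq
    rcases hs.eq_or_lt with h0 | h0
    · rw [← h0]
      positivity
    · exact le_of_mul_le_mul_right (by linarith) h0
end

section
/- Spectrum of the ideal Schur-complement block-diagonal preconditioned Stokes matrix (Murphy–Golub–Wathen): assume B has full row rank, so that S = B A⁻¹ Bᵀ is positive definite, and let M = [[A, 0],[0, S]]. Then every eigenvalue of M⁻¹ 𝒜 belongs to the three-element set { (1−√5)/2, 1, (1+√5)/2 }. -/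
open Matrix

/-- A matrix whose rank is its number of rows has injective left multiplication. -/
theorem Matrix.vecMul_injective_of_rank_eq_card {m n K : Type*} [Fintype m] [Fintype n] [Field K]
    {B : Matrix m n K} (h : B.rank = Fintype.card m) : Function.Injective B.vecMul := by
  rw [vecMul_injective_iff, linearIndependent_iff_card_eq_finrank_span, Set.finrank,
    ← rank_eq_finrank_span_row, h]

/-- The Schur complement `B A⁻¹ Bᵀ` is positive definite when `B` has full row rank. -/
theorem Matrix.PosDef.mul_inv_mul_transpose {m n : Type*} [Fintype m] [Fintype n] [DecidableEq n]
    {A : Matrix n n ℝ} (hA : A.PosDef) {B : Matrix m n ℝ} (h : B.rank = Fintype.card m) :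
    (B * A⁻¹ * Bᵀ).PosDef := by
  simpa using hA.inv.mul_mul_conjTranspose_same (vecMul_injective_of_rank_eq_card h)

/-- The roots of `t ^ 2 - t - 1`. -/
theorem Real.eq_or_eq_of_sq_sub_self_sub_one_eq_zero {t : ℝ} (h : t ^ 2 - t - 1 = 0) :
    t = (1 - √5) / 2 ∨ t = (1 + √5) / 2 := by
  have h5 : √5 ^ 2 = 5 := Real.sq_sqrt (by norm_num)
  have hprod : (t - (1 - √5) / 2) * (t - (1 + √5) / 2) = 0 := by
    linear_combination h - h5 / 4
  simpa [sub_eq_zero] using hprod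

/-- Spectrum of the ideal Schur-complement block-diagonal preconditioned Stokes
matrix (Murphy–Golub–Wathen): if B has full row rank then every eigenvalue of
M⁻¹ 𝒜, with M = [[A,0],[0,S]], lies in { (1−√5)/2, 1, (1+√5)/2 }. -/
theorem stmt_6 {nu np : ℕ} (hnu : 0 < nu) (hnp : 0 < np)
    (A : Matrix (Fin nu) (Fin nu) ℝ) (hA : A.PosDef)
    (B : Matrix (Fin np) (Fin nu) ℝ) (hrank : B.rank = np) :
    ∀ (lam : ℝ) (x : Fin nu ⊕ Fin np → ℝ), x ≠ 0 →
      ((fromBlocks A 0 0 (B * A⁻¹ * Bᵀ))⁻¹ *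
          fromBlocks A Bᵀ B (0 : Matrix (Fin np) (Fin np) ℝ)) *ᵥ x = lam • x →
      lam = (1 - Real.sqrt 5) / 2 ∨ lam = 1 ∨ lam = (1 + Real.sqrt 5) / 2 := by
  intro lam x hx h
  have hS : (B * A⁻¹ * Bᵀ).PosDef := hA.mul_inv_mul_transpose (by simpa using hrank)
  have hAdet : IsUnit A.det := (isUnit_iff_isUnit_det A).1 hA.isUnit
  have hMdet : IsUnit (fromBlocks A 0 0 (B * A⁻¹ * Bᵀ)).det := by
    rw [det_fromBlocks_zero₂₁]
    exact hAdet.mul ((isUnit_iff_isUnit_det _).1 hS.isUnit)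
  have hgen : fromBlocks A Bᵀ B 0 *ᵥ x = lam • (fromBlocks A 0 0 (B * A⁻¹ * Bᵀ) *ᵥ x) := by
    rw [← mulVec_smul, ← h, mulVec_mulVec, mul_nonsing_inv_cancel_left _ _ hMdet]
  obtain ⟨u, p, rfl⟩ : ∃ u p, x = Sum.elim u p := ⟨_, _, (Sum.elim_comp_inl_inr x).symm⟩
  have hu : A *ᵥ u + Bᵀ *ᵥ p = lam • (A *ᵥ u) := by
    funext i
    simpa [fromBlocks_mulVec] using congrFun hgen (Sum.inl i)
  have hp : B *ᵥ u = lam • ((B * A⁻¹ * Bᵀ) *ᵥ p) := by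
    funext i
    simpa [fromBlocks_mulVec] using congrFun hgen (Sum.inr i)
  have hBu : B *ᵥ u + (B * A⁻¹ * Bᵀ) *ᵥ p = lam • (B *ᵥ u) := by
    have := congrArg ((B * A⁻¹) *ᵥ ·) hu
    simpa only [mulVec_add, mulVec_smul, mulVec_mulVec,
      nonsing_inv_mul_cancel_right _ _ hAdet] using this
  have hquad : (lam ^ 2 - lam - 1) • ((B * A⁻¹ * Bᵀ) *ᵥ p) = 0 := by
    rw [hp] at hBu
    linear_combination (norm := module) -hBu
  rcases smul_eq_zero.1 hquad with hroot | hSp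
  · rcases Real.eq_or_eq_of_sq_sub_self_sub_one_eq_zero hroot with h | h <;> simp [h]
  · have hp0 : p = 0 := mulVec_injective_of_isUnit hS.isUnit (by simpa using hSp)
    subst hp0
    have hu0 : u ≠ 0 := by
      rintro rfl
      exact hx (by simp)
    have hAu : A *ᵥ u ≠ 0 := fun h0 =>
      hu0 (mulVec_injective_of_isUnit hA.isUnit (by simpa using h0))
    right; left
    refine smul_left_injective ℝ hAu ?_
    simpa using hu.symm
end

section
/- Convergence of the ideally preconditioned MINRES in at most three iterations: assume B has full row rank, so that S = B A⁻¹ Bᵀ is positive definite, let M = [[A, 0],[0, S]] and T = M⁻¹ 𝒜. Then for every c ∈ ℝ^{n_u+n_p} and every initial guess x₀ ∈ ℝ^{n_u+n_p}, setting r₀ = c − T x₀, there exists x in the affine Krylov space x₀ + span{ r₀, T r₀, T² r₀ } with T x = c. -/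
open Matrix

/-- The Schur complement `B A⁻¹ Bᵀ` is positive definite when `A` is and `B` has full row rank. -/
theorem posDef_schurComplement {m n : Type*} [Fintype m] [Fintype n] [DecidableEq n]
    {A : Matrix n n ℝ} (hA : A.PosDef) {B : Matrix m n ℝ} (hrank : B.rank = Fintype.card m) :
    (B * A⁻¹ * Bᵀ).PosDef := by
  have hrows : LinearIndependent ℝ B.row := by
    rw [linearIndependent_iff_card_eq_finrank_span, ← hrank, B.rank_eq_finrank_span_row]
    rfl
  simpa [conjTranspose_eq_transpose_of_trivial] using
    hA.inv.mul_mul_conjTranspose_same (vecMul_injective_iff.mpr hrows)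

/-- If `F * E = 1`, the block matrix `P = [[1, E], [F, 0]]` satisfies `P³ - 2 P² + 1 = 0`,
written here as an explicit right inverse of `P`. -/
theorem fromBlocks_one_zero_mul_two_smul_sub_sq {R m n : Type*} [CommRing R]
    [Fintype m] [Fintype n] [DecidableEq m] [DecidableEq n]
    {E : Matrix n m R} {F : Matrix m n R} (hFE : F * E = 1) :
    fromBlocks 1 E F 0 * ((2 : R) • fromBlocks 1 E F 0 -
      fromBlocks 1 E F 0 * fromBlocks 1 E F 0) = 1 := by
  have hFEF : F * (E * F) = F := by rw [← Matrix.mul_assoc, hFE, Matrix.one_mul]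
  simp only [Matrix.mul_neg, two_smul, Matrix.mul_add, fromBlocks_multiply, sub_eq_add_neg,
    fromBlocks_neg, fromBlocks_add, ← fromBlocks_one, Matrix.one_mul, Matrix.mul_one,
    Matrix.mul_zero, Matrix.zero_mul, hFE, hFEF]
  congr 1 <;> abel

/-- The ideally preconditioned saddle-point matrix in block form. -/
theorem inv_fromBlocks_mul_saddlePoint {R m n : Type*} [CommRing R]
    [Fintype m] [Fintype n] [DecidableEq m] [DecidableEq n]
    {A : Matrix n n R} {S : Matrix m m R} (hA : IsUnit A.det) (hS : IsUnit S.det)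
    (B : Matrix m n R) (C : Matrix n m R) :
    (fromBlocks A 0 0 S)⁻¹ * fromBlocks A C B 0 = fromBlocks 1 (A⁻¹ * C) (S⁻¹ * B) 0 := by
  have hM : (fromBlocks A 0 0 S)⁻¹ = fromBlocks A⁻¹ 0 0 S⁻¹ := by
    apply inv_eq_right_inv
    simp [fromBlocks_multiply, mul_nonsing_inv _ hA, mul_nonsing_inv _ hS]
  simp [hM, fromBlocks_multiply, nonsing_inv_mul _ hA]

/-- Convergence of the ideally preconditioned MINRES in at most three
iterations: with T = M⁻¹ 𝒜, M = [[A,0],[0,S]], for every c and initial guess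
x₀, setting r₀ = c − T x₀, there exists x ∈ x₀ + span{r₀, T r₀, T² r₀}
with T x = c. -/
theorem stmt_8 {nu np : ℕ} (hnu : 0 < nu) (hnp : 0 < np)
    (A : Matrix (Fin nu) (Fin nu) ℝ) (hA : A.PosDef)
    (B : Matrix (Fin np) (Fin nu) ℝ) (hrank : B.rank = np)
    (T : Matrix (Fin nu ⊕ Fin np) (Fin nu ⊕ Fin np) ℝ)
    (hT : T = (fromBlocks A 0 0 (B * A⁻¹ * Bᵀ))⁻¹ *
      fromBlocks A Bᵀ B (0 : Matrix (Fin np) (Fin np) ℝ))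
    (c x₀ : Fin nu ⊕ Fin np → ℝ) (r₀ : Fin nu ⊕ Fin np → ℝ)
    (hr₀ : r₀ = c - T *ᵥ x₀) :
    ∃ y ∈ Submodule.span ℝ {r₀, T *ᵥ r₀, T *ᵥ (T *ᵥ r₀)},
      T *ᵥ (x₀ + y) = c := by
  have hS := posDef_schurComplement hA (hrank.trans (Fintype.card_fin np).symm)
  have hAdet : IsUnit A.det := hA.det_pos.ne'.isUnit
  have hSdet : IsUnit (B * A⁻¹ * Bᵀ).det := hS.det_pos.ne'.isUnit
  have hFE : (B * A⁻¹ * Bᵀ)⁻¹ * B * (A⁻¹ * Bᵀ) = 1 := by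
    simpa only [Matrix.mul_assoc] using nonsing_inv_mul _ hSdet
  have hinv : T * ((2 : ℝ) • T - T * T) = 1 := by
    rw [hT, inv_fromBlocks_mul_saddlePoint hAdet hSdet]
    exact fromBlocks_one_zero_mul_two_smul_sub_sq hFE
  refine ⟨(2 : ℝ) • T *ᵥ r₀ - T *ᵥ (T *ᵥ r₀), ?_, ?_⟩
  · exact Submodule.sub_mem _
      (Submodule.smul_mem _ _ (Submodule.subset_span (by simp)))
      (Submodule.subset_span (by simp))
  · have hy : T *ᵥ ((2 : ℝ) • T *ᵥ r₀ - T *ᵥ (T *ᵥ r₀)) = r₀ := by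
      rw [mulVec_mulVec, ← smul_mulVec, ← sub_mulVec, mulVec_mulVec, hinv, one_mulVec]
    rw [mulVec_add, hy, hr₀, add_sub_cancel]
end

section
/- Eigenvalue inclusion for the ideal mass-matrix block-diagonal preconditioner: let Q be a real symmetric positive definite n_p×n_p matrix and β₀, C_b > 0 such that β₀² ⟨Q p, p⟩ ≤ ⟨S p, p⟩ ≤ C_b² ⟨Q p, p⟩ for every p ∈ ℝ^{n_p} with Bᵀ p ≠ 0. Let M = [[A, 0],[0, Q]]. Then every nonzero real eigenvalue λ of M⁻¹ 𝒜 lies in the union [ (1−√(1+4C_b²))/2, (1−√(1+4β₀²))/2 ] ∪ {1} ∪ [ (1+√(1+4β₀²))/2, (1+√(1+4C_b²))/2 ]. -/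
open Matrix

/-- If `a ≤ t * (t - 1) ≤ b`, then `t` lies between the corresponding roots of
`t * (t - 1) = a` and `t * (t - 1) = b`, on the negative or on the positive branch. -/
theorem mem_Icc_union_Icc_of_mul_sub_one_mem {a b t : ℝ}
    (ha : a ≤ t * (t - 1)) (hb : t * (t - 1) ≤ b) :
    t ∈ Set.Icc ((1 - √(1 + 4 * b)) / 2) ((1 - √(1 + 4 * a)) / 2) ∪
      Set.Icc ((1 + √(1 + 4 * a)) / 2) ((1 + √(1 + 4 * b)) / 2) := by
  have hlow : √(1 + 4 * a) ≤ |2 * t - 1| := by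
    rw [← Real.sqrt_sq_eq_abs]
    exact Real.sqrt_le_sqrt (by linarith)
  have hupp : |2 * t - 1| ≤ √(1 + 4 * b) := by
    rw [← Real.sqrt_sq_eq_abs]
    exact Real.sqrt_le_sqrt (by linarith)
  rcases le_total 0 (2 * t - 1) with h | h
  · rw [abs_of_nonneg h] at hlow hupp
    exact Or.inr ⟨by linarith, by linarith⟩
  · rw [abs_of_nonpos h] at hlow hupp
    exact Or.inl ⟨by linarith, by linarith⟩

/-- Eigenpairs of the block-diagonally preconditioned saddle-point matrix solve the
generalized eigenvalue problem, written by blocks. -/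
theorem saddle_point_block_equations {m n : Type*} [Fintype m] [Fintype n] [DecidableEq m]
    [DecidableEq n] {A : Matrix m m ℝ} {Q : Matrix n n ℝ} (hA : IsUnit A) (hQ : IsUnit Q)
    (B : Matrix n m ℝ) {lam : ℝ} {x : m ⊕ n → ℝ}
    (hx : ((fromBlocks A 0 0 Q)⁻¹ * fromBlocks A Bᵀ B 0) *ᵥ x = lam • x) :
    A *ᵥ (x ∘ Sum.inl) + Bᵀ *ᵥ (x ∘ Sum.inr) = lam • A *ᵥ (x ∘ Sum.inl) ∧
      B *ᵥ (x ∘ Sum.inl) = lam • Q *ᵥ (x ∘ Sum.inr) := by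
  have hM : IsUnit (fromBlocks A 0 0 Q).det := by
    rw [det_fromBlocks_zero₂₁]
    exact ((isUnit_iff_isUnit_det A).1 hA).mul ((isUnit_iff_isUnit_det Q).1 hQ)
  have h := congrArg (fun v => fromBlocks A 0 0 Q *ᵥ v) hx
  simp only [mulVec_mulVec, mul_nonsing_inv_cancel_left _ _ hM, mulVec_smul,
    fromBlocks_mulVec] at h
  constructor
  · funext i
    simpa using congrFun h (Sum.inl i)
  · funext i
    simpa using congrFun h (Sum.inr i)

/-- Eigenvalue inclusion for the ideal mass-matrix block-diagonal
preconditioner M = [[A,0],[0,Q]]: under the spectral equivalence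
β₀² ⟨Qp,p⟩ ≤ ⟨Sp,p⟩ ≤ C_b² ⟨Qp,p⟩ for Bᵀp ≠ 0, every nonzero real eigenvalue
of M⁻¹ 𝒜 lies in
[ (1−√(1+4C_b²))/2, (1−√(1+4β₀²))/2 ] ∪ {1} ∪ [ (1+√(1+4β₀²))/2, (1+√(1+4C_b²))/2 ]. -/
theorem stmt_9 {nu np : ℕ} (hnu : 0 < nu) (hnp : 0 < np)
    (A : Matrix (Fin nu) (Fin nu) ℝ) (hA : A.PosDef)
    (B : Matrix (Fin np) (Fin nu) ℝ)
    (Q : Matrix (Fin np) (Fin np) ℝ) (hQ : Q.PosDef)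
    (β₀ Cb : ℝ) (hβ₀ : 0 < β₀) (hCb : 0 < Cb)
    (hequiv : ∀ p : Fin np → ℝ, Bᵀ *ᵥ p ≠ 0 →
      β₀ ^ 2 * (Q *ᵥ p ⬝ᵥ p) ≤ (B * A⁻¹ * Bᵀ) *ᵥ p ⬝ᵥ p ∧
      (B * A⁻¹ * Bᵀ) *ᵥ p ⬝ᵥ p ≤ Cb ^ 2 * (Q *ᵥ p ⬝ᵥ p)) :
    ∀ (lam : ℝ) (x : Fin nu ⊕ Fin np → ℝ), lam ≠ 0 → x ≠ 0 →
      ((fromBlocks A 0 0 Q)⁻¹ *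
          fromBlocks A Bᵀ B (0 : Matrix (Fin np) (Fin np) ℝ)) *ᵥ x = lam • x →
      lam ∈ Set.Icc ((1 - Real.sqrt (1 + 4 * Cb ^ 2)) / 2)
              ((1 - Real.sqrt (1 + 4 * β₀ ^ 2)) / 2) ∪
            {1} ∪
            Set.Icc ((1 + Real.sqrt (1 + 4 * β₀ ^ 2)) / 2)
              ((1 + Real.sqrt (1 + 4 * Cb ^ 2)) / 2) := by
  intro lam x hlam hx hev
  obtain ⟨hu, hp⟩ := saddle_point_block_equations hA.isUnit hQ.isUnit B hev
  set u := x ∘ Sum.inl with hu_def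
  set p := x ∘ Sum.inr with hp_def
  by_cases hone : lam = 1
  · exact Or.inl (Or.inr hone)
  have hBt : Bᵀ *ᵥ p = (lam - 1) • A *ᵥ u := by
    rw [sub_smul, one_smul, ← hu, add_sub_cancel_left]
  have hBp : Bᵀ *ᵥ p ≠ 0 := by
    intro h0
    have hAu : A *ᵥ u = 0 :=
      (smul_eq_zero.1 (hBt.symm.trans h0)).resolve_left (sub_ne_zero.2 hone)
    have hu0 : u = 0 :=
      mulVec_injective_of_isUnit hA.isUnit (hAu.trans (mulVec_zero A).symm)
    have hQp : Q *ᵥ p = 0 := by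
      rw [hu0, mulVec_zero] at hp
      exact (smul_eq_zero.1 hp.symm).resolve_left hlam
    have hp0 : p = 0 :=
      mulVec_injective_of_isUnit hQ.isUnit (hQp.trans (mulVec_zero Q).symm)
    apply hx
    rw [← Sum.elim_comp_inl_inr x, ← hu_def, ← hp_def, hu0, hp0]
    exact Sum.elim_zero_zero
  have hp0 : p ≠ 0 := fun h => hBp (by rw [h, mulVec_zero])
  have hq : 0 < Q *ᵥ p ⬝ᵥ p := by
    have := hQ.dotProduct_mulVec_pos hp0
    rwa [star_trivial, dotProduct_comm] at this
  have hS : (B * A⁻¹ * Bᵀ) *ᵥ p = (lam * (lam - 1)) • Q *ᵥ p := by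
    rw [← mulVec_mulVec, hBt, mulVec_smul, mulVec_mulVec, Matrix.mul_assoc,
      nonsing_inv_mul _ ((isUnit_iff_isUnit_det A).1 hA.isUnit), Matrix.mul_one, hp, smul_smul,
      mul_comm]
  obtain ⟨hlow, hupp⟩ := hequiv p hBp
  rw [hS, smul_dotProduct, smul_eq_mul] at hlow hupp
  rcases mem_Icc_union_Icc_of_mul_sub_one_mem (le_of_mul_le_mul_right hlow hq)
    (le_of_mul_le_mul_right hupp hq) with h | h
  · exact Or.inl (Or.inl h)
  · exact Or.inr h
end

section
/- Wathen–Silvester eigenvalue bounds for general block-diagonal preconditioners: let Q, M_A, M_Q be real symmetric positive definite matrices of sizes n_p×n_p, n_u×n_u and n_p×n_p respectively, and let γ_A, Γ_A, γ_Q, Γ_Q, β₀, C_b > 0 satisfy: γ_A ≤ ⟨A u, u⟩ / ⟨M_A u, u⟩ ≤ Γ_A for all u ∈ ℝ^{n_u}, u ≠ 0; γ_Q ≤ ⟨Q p, p⟩ / ⟨M_Q p, p⟩ ≤ Γ_Q for all p ∈ ℝ^{n_p}, p ≠ 0; and β₀² ≤ ⟨S p, p⟩ / ⟨Q p, p⟩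 ≤ C_b² for all p ∈ ℝ^{n_p} with Bᵀ p ≠ 0. Let M = [[M_A, 0],[0, M_Q]]. Then every nonzero real eigenvalue λ of M⁻¹ 𝒜 lies in the union of intervals [ (γ_A − √(γ_A² + 4 C_b² Γ_A Γ_Q))/2, (γ_A − √(γ_A² + 4 β₀² γ_A γ_Q))/2 ] ∪ [ γ_A, (Γ_A + √(Γ_A² + 4 C_b² Γ_A Γ_Q))/2 ]. -/
open Matrix

section QuadraticForms

variable {m n : Type*} [Fintype m] [Fintype n]

theorem Matrix.PosDef.mulVec_dotProduct_pos_s10 {M : Matrix n n ℝ} (hM : M.PosDef) {x : n → ℝ}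
    (hx : x ≠ 0) : 0 < M *ᵥ x ⬝ᵥ x := by
  have h := hM.dotProduct_mulVec_pos hx
  rwa [star_trivial, dotProduct_comm] at h

theorem Matrix.PosDef.mulVec_dotProduct_nonneg {M : Matrix n n ℝ} (hM : M.PosDef) (x : n → ℝ) :
    0 ≤ M *ᵥ x ⬝ᵥ x := by
  rcases eq_or_ne x 0 with rfl | hx
  · simp
  · exact (hM.mulVec_dotProduct_pos_s10 hx).le

theorem Matrix.mulVec_dotProduct_eq_transpose (M : Matrix m n ℝ) (x : n → ℝ) (y : m → ℝ) :
    M *ᵥ x ⬝ᵥ y = Mᵀ *ᵥ y ⬝ᵥ x := by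
  rw [dotProduct_comm, dotProduct_mulVec, mulVec_transpose]

theorem Matrix.PosDef.mulVec_dotProduct_comm {M : Matrix n n ℝ} (hM : M.PosDef) (x y : n → ℝ) :
    M *ᵥ x ⬝ᵥ y = M *ᵥ y ⬝ᵥ x := by
  have hT : Mᵀ = M := by simpa using hM.isHermitian.eq
  rw [mulVec_dotProduct_eq_transpose, hT]

/-- Cauchy–Schwarz for the inner product of a positive definite matrix. -/
theorem Matrix.PosDef.sq_mulVec_dotProduct_le {M : Matrix n n ℝ} (hM : M.PosDef) (x y : n → ℝ) :
    (M *ᵥ x ⬝ᵥ y) ^ 2 ≤ (M *ᵥ x ⬝ᵥ x) * (M *ᵥ y ⬝ᵥ y) := by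
  have h : ∀ t : ℝ, 0 ≤ (M *ᵥ x ⬝ᵥ x) * (t * t) + 2 * (M *ᵥ x ⬝ᵥ y) * t + M *ᵥ y ⬝ᵥ y := by
    intro t
    have ht := hM.mulVec_dotProduct_nonneg (t • x + y)
    simp only [mulVec_add, mulVec_smul, add_dotProduct, dotProduct_add, smul_dotProduct,
      dotProduct_smul, smul_eq_mul, hM.mulVec_dotProduct_comm y x] at ht
    linarith
  have hd := discrim_le_zero h
  rw [discrim] at hd
  linarith

/-- If `γ ⟨M v, v⟩ ≤ ⟨A v, v⟩` for all `v`, then `γ M A⁻¹ M ≤ M` as quadratic forms. -/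
theorem Matrix.PosDef.mul_mulVec_inv_mulVec_dotProduct_le [DecidableEq n] {A M : Matrix n n ℝ}
    (hA : A.PosDef) (hM : M.PosDef) {γ : ℝ} (hγ : 0 ≤ γ)
    (h : ∀ v, γ * (M *ᵥ v ⬝ᵥ v) ≤ A *ᵥ v ⬝ᵥ v) (u : n → ℝ) :
    γ * (M *ᵥ u ⬝ᵥ A⁻¹ *ᵥ (M *ᵥ u)) ≤ M *ᵥ u ⬝ᵥ u := by
  set y := A⁻¹ *ᵥ (M *ᵥ u) with hy
  have hAy : A *ᵥ y = M *ᵥ u := by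
    rw [hy, mulVec_mulVec, mul_nonsing_inv _ hA.det_pos.ne'.isUnit, one_mulVec]
  have hz := hA.mulVec_dotProduct_nonneg y
  have hγy := h y
  rw [hAy] at hz hγy
  have hcs := hM.sq_mulVec_dotProduct_le u y
  have hm := hM.mulVec_dotProduct_nonneg u
  rcases hz.eq_or_lt with h0 | h0
  · rw [← h0]; simpa using hm
  · refine le_of_mul_le_mul_right ?_ h0
    nlinarith [mul_le_mul_of_nonneg_left hcs hγ, mul_le_mul_of_nonneg_left hγy hm]

end QuadraticForms

theorem sub_sqrt_sq_add_le_sub_sqrt_sq_add {g G c : ℝ} (hg : 0 ≤ g) (hgG : g ≤ G) (hc : 0 ≤ c) :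
    g - √(g ^ 2 + c) ≤ G - √(G ^ 2 + c) := by
  have h1 := Real.sq_sqrt (show 0 ≤ g ^ 2 + c by positivity)
  have h2 : g ≤ √(g ^ 2 + c) := Real.le_sqrt_of_sq_le (by linarith)
  have h3 : √(G ^ 2 + c) ≤ G - g + √(g ^ 2 + c) := by
    rw [Real.sqrt_le_left (by linarith)]
    nlinarith [mul_nonneg (sub_nonneg.2 hgG) (sub_nonneg.2 h2)]
  linarith

theorem eq_of_fromBlocks_inv_mul_mulVec_eq_smul {m n : Type*} [Fintype m] [Fintype n]
    [DecidableEq m] [DecidableEq n] {A MA : Matrix n n ℝ} {B : Matrix m n ℝ} {MQ : Matrix m m ℝ}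
    (hMA : MA.PosDef) (hMQ : MQ.PosDef) {lam : ℝ} {x : n ⊕ m → ℝ}
    (h : ((fromBlocks MA 0 0 MQ)⁻¹ * fromBlocks A Bᵀ B (0 : Matrix m m ℝ)) *ᵥ x = lam • x) :
    A *ᵥ (x ∘ Sum.inl) + Bᵀ *ᵥ (x ∘ Sum.inr) = lam • MA *ᵥ (x ∘ Sum.inl) ∧
      B *ᵥ (x ∘ Sum.inl) = lam • MQ *ᵥ (x ∘ Sum.inr) := by
  have hdet : IsUnit (fromBlocks MA 0 0 MQ).det := by
    rw [det_fromBlocks_zero₂₁]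
    exact (mul_pos hMA.det_pos hMQ.det_pos).ne'.isUnit
  have h' := congrArg (fun v => fromBlocks MA 0 0 MQ *ᵥ v) h
  simp only [mulVec_mulVec, mul_nonsing_inv_cancel_left _ _ hdet, mulVec_smul,
    fromBlocks_mulVec] at h'
  constructor
  · ext i
    simpa using congrFun h' (Sum.inl i)
  · ext i
    simpa using congrFun h' (Sum.inr i)

/-- Wathen–Silvester eigenvalue bounds for general block-diagonal
preconditioners M = [[M_A,0],[0,M_Q]]: every nonzero real eigenvalue of
M⁻¹ 𝒜 lies in
[ (γ_A − √(γ_A² + 4C_b²Γ_AΓ_Q))/2, (γ_A − √(γ_A² + 4β₀²γ_Aγ_Q))/2 ]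
∪ [ γ_A, (Γ_A + √(Γ_A² + 4C_b²Γ_AΓ_Q))/2 ]. -/
theorem stmt_10 {nu np : ℕ} (hnu : 0 < nu) (hnp : 0 < np)
    (A : Matrix (Fin nu) (Fin nu) ℝ) (hA : A.PosDef)
    (B : Matrix (Fin np) (Fin nu) ℝ)
    (Q : Matrix (Fin np) (Fin np) ℝ) (hQ : Q.PosDef)
    (MA : Matrix (Fin nu) (Fin nu) ℝ) (hMA : MA.PosDef)
    (MQ : Matrix (Fin np) (Fin np) ℝ) (hMQ : MQ.PosDef)
    (γA ΓA γQ ΓQ β₀ Cb : ℝ)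
    (hγA : 0 < γA) (hΓA : 0 < ΓA) (hγQ : 0 < γQ) (hΓQ : 0 < ΓQ)
    (hβ₀ : 0 < β₀) (hCb : 0 < Cb)
    (hAbounds : ∀ u : Fin nu → ℝ, u ≠ 0 →
      γA ≤ (A *ᵥ u ⬝ᵥ u) / (MA *ᵥ u ⬝ᵥ u) ∧ (A *ᵥ u ⬝ᵥ u) / (MA *ᵥ u ⬝ᵥ u) ≤ ΓA)
    (hQbounds : ∀ p : Fin np → ℝ, p ≠ 0 →
      γQ ≤ (Q *ᵥ p ⬝ᵥ p) / (MQ *ᵥ p ⬝ᵥ p) ∧ (Q *ᵥ p ⬝ᵥ p) / (MQ *ᵥ p ⬝ᵥ p) ≤ ΓQ)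
    (hSbounds : ∀ p : Fin np → ℝ, Bᵀ *ᵥ p ≠ 0 →
      β₀ ^ 2 ≤ ((B * A⁻¹ * Bᵀ) *ᵥ p ⬝ᵥ p) / (Q *ᵥ p ⬝ᵥ p) ∧
      ((B * A⁻¹ * Bᵀ) *ᵥ p ⬝ᵥ p) / (Q *ᵥ p ⬝ᵥ p) ≤ Cb ^ 2) :
    ∀ (lam : ℝ) (x : Fin nu ⊕ Fin np → ℝ), lam ≠ 0 → x ≠ 0 →
      ((fromBlocks MA 0 0 MQ)⁻¹ *
          fromBlocks A Bᵀ B (0 : Matrix (Fin np) (Fin np) ℝ)) *ᵥ x = lam • x →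
      lam ∈ Set.Icc ((γA - Real.sqrt (γA ^ 2 + 4 * Cb ^ 2 * ΓA * ΓQ)) / 2)
              ((γA - Real.sqrt (γA ^ 2 + 4 * β₀ ^ 2 * γA * γQ)) / 2) ∪
            Set.Icc γA ((ΓA + Real.sqrt (ΓA ^ 2 + 4 * Cb ^ 2 * ΓA * ΓQ)) / 2) := by
  intro lam x hlam hx hev
  obtain ⟨hu, hp⟩ := eq_of_fromBlocks_inv_mul_mulVec_eq_smul hMA hMQ hev
  have hx' : x = Sum.elim (x ∘ Sum.inl) (x ∘ Sum.inr) := (Sum.elim_comp_inl_inr x).symm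
  generalize x ∘ Sum.inl = u at hu hp hx'
  generalize x ∘ Sum.inr = p at hu hp hx'
  have hu0 : u ≠ 0 := by
    rintro rfl
    have hp0 : p ≠ 0 := by
      rintro rfl
      exact hx (by rw [hx']; ext i; cases i <;> rfl)
    rw [mulVec_zero, eq_comm, smul_eq_zero] at hp
    have := hMQ.mulVec_dotProduct_pos_s10 hp0
    rw [hp.resolve_left hlam, zero_dotProduct] at this
    exact this.false
  have ham : ∀ v, γA * (MA *ᵥ v ⬝ᵥ v) ≤ A *ᵥ v ⬝ᵥ v := by
    intro v
    rcases eq_or_ne v 0 with rfl | hv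
    · simp
    · exact (le_div_iff₀ (hMA.mulVec_dotProduct_pos_s10 hv)).1 (hAbounds v hv).1
  have hm := hMA.mulVec_dotProduct_pos_s10 hu0
  have ha := hA.mulVec_dotProduct_pos_s10 hu0
  have hq := hMQ.mulVec_dotProduct_nonneg p
  have hamu := ham u
  have haM := (div_le_iff₀ hm).1 (hAbounds u hu0).2
  have hγΓ : γA ≤ ΓA := (hAbounds u hu0).1.trans (hAbounds u hu0).2
  have hBup : Bᵀ *ᵥ p ⬝ᵥ u = lam * (MQ *ᵥ p ⬝ᵥ p) := by
    rw [← mulVec_dotProduct_eq_transpose, hp, smul_dotProduct, smul_eq_mul]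
  have hid : A *ᵥ u ⬝ᵥ u + lam * (MQ *ᵥ p ⬝ᵥ p) = lam * (MA *ᵥ u ⬝ᵥ u) := by
    rw [← hBup, ← add_dotProduct, hu, smul_dotProduct, smul_eq_mul]
  have hAinv : ∀ w, A *ᵥ (A⁻¹ *ᵥ w) = w := fun w => by
    rw [mulVec_mulVec, mul_nonsing_inv _ hA.det_pos.ne'.isUnit, one_mulVec]
  have hinvA : ∀ w, A⁻¹ *ᵥ (A *ᵥ w) = w := fun w => by
    rw [mulVec_mulVec, nonsing_inv_mul _ hA.det_pos.ne'.isUnit, one_mulVec]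
  have hs : (B * A⁻¹ * Bᵀ) *ᵥ p ⬝ᵥ p = Bᵀ *ᵥ p ⬝ᵥ A⁻¹ *ᵥ (Bᵀ *ᵥ p) := by
    rw [← mulVec_mulVec, ← mulVec_mulVec, mulVec_dotProduct_eq_transpose]
  have hSQ : Bᵀ *ᵥ p ≠ 0 →
      β₀ ^ 2 * γQ * (MQ *ᵥ p ⬝ᵥ p) ≤ Bᵀ *ᵥ p ⬝ᵥ A⁻¹ *ᵥ (Bᵀ *ᵥ p) ∧
      Bᵀ *ᵥ p ⬝ᵥ A⁻¹ *ᵥ (Bᵀ *ᵥ p) ≤ Cb ^ 2 * ΓQ * (MQ *ᵥ p ⬝ᵥ p) := by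
    intro hBp
    have hp0 : p ≠ 0 := by
      rintro rfl
      exact hBp (mulVec_zero _)
    have hQ1 := (le_div_iff₀ (hMQ.mulVec_dotProduct_pos_s10 hp0)).1 (hQbounds p hp0).1
    have hQ2 := (div_le_iff₀ (hMQ.mulVec_dotProduct_pos_s10 hp0)).1 (hQbounds p hp0).2
    have hS1 := (le_div_iff₀ (hQ.mulVec_dotProduct_pos_s10 hp0)).1 (hSbounds p hBp).1
    have hS2 := (div_le_iff₀ (hQ.mulVec_dotProduct_pos_s10 hp0)).1 (hSbounds p hBp).2
    rw [hs] at hS1 hS2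
    constructor
    · linarith [mul_le_mul_of_nonneg_left hQ1 (sq_nonneg β₀)]
    · linarith [mul_le_mul_of_nonneg_left hQ2 (sq_nonneg Cb)]
  have hqa : lam ^ 2 * (MQ *ᵥ p ⬝ᵥ p) ≤ Cb ^ 2 * ΓQ * (A *ᵥ u ⬝ᵥ u) := by
    rcases hq.eq_or_lt with h0 | h0
    · rw [← h0, mul_zero]
      positivity
    · have hBp : Bᵀ *ᵥ p ≠ 0 := by
        intro h
        rw [h, zero_dotProduct] at hBup
        exact mul_ne_zero hlam h0.ne' hBup.symm
      have hcs := hA.sq_mulVec_dotProduct_le (A⁻¹ *ᵥ (Bᵀ *ᵥ p)) u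
      rw [hAinv, hBup] at hcs
      refine le_of_mul_le_mul_right ?_ h0
      linarith [mul_le_mul_of_nonneg_right (hSQ hBp).2 ha.le]
  rcases hlam.lt_or_gt with hneg | hpos
  · left
    have hBp : Bᵀ *ᵥ p ≠ 0 := by
      intro h
      rw [h, zero_dotProduct] at hBup
      nlinarith [mul_pos_of_neg_of_neg hneg (neg_neg_of_pos hm)]
    have hlow : -lam * (ΓA - lam) ≤ Cb ^ 2 * ΓQ * ΓA := by
      refine le_of_mul_le_mul_right ?_ ha
      linarith [mul_le_mul_of_nonneg_left haM (sq_nonneg lam),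
        mul_le_mul_of_nonneg_left hqa hΓA.le, congrArg (ΓA * lam * ·) hid]
    have hw : Bᵀ *ᵥ p = lam • MA *ᵥ u - A *ᵥ u := by
      rw [← hu, add_sub_cancel_left]
    have hsu : Bᵀ *ᵥ p ⬝ᵥ A⁻¹ *ᵥ (Bᵀ *ᵥ p) = A *ᵥ u ⬝ᵥ u - 2 * lam * (MA *ᵥ u ⬝ᵥ u) +
        lam ^ 2 * (MA *ᵥ u ⬝ᵥ A⁻¹ *ᵥ (MA *ᵥ u)) := by
      have hcross : A *ᵥ u ⬝ᵥ A⁻¹ *ᵥ (MA *ᵥ u) = MA *ᵥ u ⬝ᵥ u := by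
        rw [hA.mulVec_dotProduct_comm, hAinv]
      rw [hw]
      simp only [mulVec_sub, mulVec_smul, hinvA, sub_dotProduct, dotProduct_sub, smul_dotProduct,
        dotProduct_smul, smul_eq_mul, hcross]
      ring
    have hMAM := hA.mul_mulVec_inv_mulVec_dotProduct_le hMA hγA.le ham u
    have hup : β₀ ^ 2 * γQ * γA ≤ -lam * (γA - lam) := by
      have hpos : 0 < A *ᵥ u ⬝ᵥ u + -lam * (MA *ᵥ u ⬝ᵥ u) :=
        add_pos ha (mul_pos (neg_pos.2 hneg) hm)
      have hS := (hSQ hBp).1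
      rw [hsu] at hS
      generalize MA *ᵥ u ⬝ᵥ A⁻¹ *ᵥ (MA *ᵥ u) = z at hS hMAM
      generalize MA *ᵥ u ⬝ᵥ u = m at *
      generalize A *ᵥ u ⬝ᵥ u = a at *
      generalize MQ *ᵥ p ⬝ᵥ p = q at *
      obtain ⟨μ, rfl⟩ : ∃ μ, lam = -μ := ⟨-lam, by ring⟩
      have hμ : 0 < μ := by linarith
      refine le_of_mul_le_mul_right ?_ hpos
      have e : a + - -μ * m = μ * q := by linarith
      calc β₀ ^ 2 * γQ * γA * (a + - -μ * m) = μ * γA * (β₀ ^ 2 * γQ * q) := by rw [e]; ring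
        _ ≤ μ * γA * (a - 2 * -μ * m + (-μ) ^ 2 * z) := by gcongr
        _ = μ * γA * a + 2 * μ ^ 2 * γA * m + μ ^ 3 * (γA * z) := by ring
        _ ≤ μ * γA * a + 2 * μ ^ 2 * γA * m + μ ^ 3 * m := by gcongr
        _ = μ * γA * a + μ ^ 2 * γA * m + μ ^ 2 * (γA * m) + μ ^ 3 * m := by ring
        _ ≤ μ * γA * a + μ ^ 2 * γA * m + μ ^ 2 * a + μ ^ 3 * m := by gcongr
        _ = - -μ * (γA - -μ) * (a + - -μ * m) := by ring
    constructor
    · have hmono := sub_sqrt_sq_add_le_sub_sqrt_sq_add hγA.le hγΓ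
        (show 0 ≤ 4 * Cb ^ 2 * ΓA * ΓQ by positivity)
      have : ΓA - 2 * lam ≤ √(ΓA ^ 2 + 4 * Cb ^ 2 * ΓA * ΓQ) :=
        Real.le_sqrt_of_sq_le (by linarith)
      linarith
    · have : √(γA ^ 2 + 4 * β₀ ^ 2 * γA * γQ) ≤ γA - 2 * lam :=
        (Real.sqrt_le_left (by linarith)).2 (by linarith)
      linarith
  · right
    constructor
    · refine le_of_mul_le_mul_right ?_ hm
      linarith [mul_nonneg hpos.le hq]
    · have hup : lam ^ 2 ≤ (lam + Cb ^ 2 * ΓQ) * ΓA := by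
        refine le_of_mul_le_mul_right ?_ hm
        have hc : 0 ≤ lam + Cb ^ 2 * ΓQ := by positivity
        linarith [mul_le_mul_of_nonneg_left haM hc, congrArg (lam * ·) hid]
      have : 2 * lam - ΓA ≤ √(ΓA ^ 2 + 4 * Cb ^ 2 * ΓA * ΓQ) :=
        Real.le_sqrt_of_sq_le (by linarith)
      linarith
end

section
/- Quadratic relation for eigenvalues of the block-diagonally preconditioned Stokes matrix: let M_A and M_Q be real symmetric positive definite matrices of sizes n_u×n_u and n_p×n_p, and let M = [[M_A, 0],[0, M_Q]]. Suppose λ ≠ 0 is a real eigenvalue of M⁻¹ 𝒜 with eigenvector (u, p) ∈ ℝ^{n_u} × ℝ^{n_p}, i.e., A u + Bᵀ p = λ M_A u and B u = λ M_Q p with (u,p) ≠ (0,0). Then u ≠ 0 and λ² ⟨M_A u, u⟩ − λ ⟨A u, u⟩ − ⟨M_Q⁻¹ (B u), B u⟩ = 0. -/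
open Matrix

/-- Quadratic relation for eigenvalues of the block-diagonally preconditioned
Stokes matrix: if λ ≠ 0 and A u + Bᵀ p = λ M_A u, B u = λ M_Q p with
(u,p) ≠ (0,0), then u ≠ 0 and
λ² ⟨M_A u, u⟩ − λ ⟨A u, u⟩ − ⟨M_Q⁻¹ (B u), B u⟩ = 0. -/
theorem stmt_11 {nu np : ℕ} (hnu : 0 < nu) (hnp : 0 < np)
    (A : Matrix (Fin nu) (Fin nu) ℝ) (hA : A.PosDef)
    (B : Matrix (Fin np) (Fin nu) ℝ)
    (MA : Matrix (Fin nu) (Fin nu) ℝ) (hMA : MA.PosDef)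
    (MQ : Matrix (Fin np) (Fin np) ℝ) (hMQ : MQ.PosDef)
    (lam : ℝ) (hlam : lam ≠ 0)
    (u : Fin nu → ℝ) (p : Fin np → ℝ) (hup : ¬(u = 0 ∧ p = 0))
    (h1 : A *ᵥ u + Bᵀ *ᵥ p = lam • (MA *ᵥ u))
    (h2 : B *ᵥ u = lam • (MQ *ᵥ p)) :
    u ≠ 0 ∧
    lam ^ 2 * (MA *ᵥ u ⬝ᵥ u) - lam * (A *ᵥ u ⬝ᵥ u)
      - (MQ⁻¹ *ᵥ (B *ᵥ u)) ⬝ᵥ (B *ᵥ u) = 0 := by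
  have hdet : IsUnit MQ.det := hMQ.det_pos.ne'.isUnit
  have hp : MQ⁻¹ *ᵥ (B *ᵥ u) = lam • p := by
    rw [h2, mulVec_smul, mulVec_mulVec, nonsing_inv_mul _ hdet, one_mulVec]
  refine ⟨fun hu => hup ⟨hu, ?_⟩, ?_⟩
  · rw [hu, mulVec_zero, mulVec_zero] at hp
    exact (smul_eq_zero.mp hp.symm).resolve_left hlam
  · have h := congrArg (· ⬝ᵥ u) h1
    simp only [add_dotProduct, smul_dotProduct, smul_eq_mul, mulVec_transpose,
      ← dotProduct_mulVec] at h
    rw [hp, smul_dotProduct, smul_eq_mul]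
    linear_combination -lam * h
end
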